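/- arXiv:1205.6056 — 2 statements merged into one kernel-verified Lean document; each statement's English description precedes it below -/
import Mathlib

section
/- For k = 10 and every integer n ≥ 5, the number of parameter tuples whose associated n-times persymmetric 2n×10 matrix over 𝔽₂ has rank 10 is Γ_10(n,10) = 2^{11n} − 1023·2^{9n} + 1022·2^{8n} + 345440·2^{7n} − 1028192·2^{6n} − 45028608·2^{5n} + 299663360·2^{4n} + 494731264·2^{3n} − 27432·2^{18}·2^{2n} + 57344·2^{18}·2^n − 256·2^{25} (an identity of integers). -/
open Finset

/-- The `2n × k` n-times persymmetric matrix over `F_2` associated to a parameter tuple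
`alpha ∈ (F_2^{k+1})^n` : for `1 ≤ j ≤ n`, rows `2j-1` and `2j` are
`(alpha^(j)_1, ..., alpha^(j)_k)` and `(alpha^(j)_2, ..., alpha^(j)_{k+1})`. -/
def persymMatrix (n k : ℕ) (α : Fin n → Fin (k + 1) → ZMod 2) :
    Matrix (Fin (2 * n)) (Fin k) (ZMod 2) :=
  Matrix.of fun r c =>
    α ⟨r.val / 2, by have := r.isLt; omega⟩ ⟨r.val % 2 + c.val, by have := c.isLt; omega⟩

/-- `Gamma n k i` is the number of parameter tuples `alpha ∈ (F_2^{k+1})^n` whose associated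
n-times persymmetric `2n × k` matrix over `F_2` has rank `i`. -/
noncomputable def Gamma (n k i : ℕ) : ℕ :=
  Nat.card {α : Fin n → Fin (k + 1) → ZMod 2 // (persymMatrix n k α).rank = i}

/-- Number of injective `b`-tuples: `∏_{i<b} (2^a - 2^i)`. -/
def injCount (a : ℕ) : ℕ → ℕ
  | 0 => 1
  | b + 1 => injCount a b * (2 ^ a - 2 ^ b)

/-- Gaussian binomial coefficient at `q = 2`. -/
def qbin (a b : ℕ) : ℕ := injCount a b / injCount b b

theorem injCount_eq_prod (a b : ℕ) : injCount a b = ∏ i : Fin b, (2 ^ a - 2 ^ i.val) := by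
  induction b with
  | zero => simp [injCount]
  | succ b ih => rw [injCount, ih, Fin.prod_univ_castSucc]; simp

theorem injCount_eq_zero {a b : ℕ} (h : a < b) : injCount a b = 0 := by
  rw [injCount_eq_prod]
  exact Finset.prod_eq_zero (Finset.mem_univ (⟨a, h⟩ : Fin b)) (by simp)

theorem injCount_pos (b : ℕ) : 0 < injCount b b := by
  rw [injCount_eq_prod]
  refine Finset.prod_pos fun i _ => ?_
  have := Nat.pow_lt_pow_right (a := 2) (by norm_num) i.isLt
  omega

theorem qbin_eq_zero {a b : ℕ} (h : a < b) : qbin a b = 0 := by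
  simp [qbin, injCount_eq_zero h]

theorem qbin_self (b : ℕ) : qbin b b = 1 := Nat.div_self (injCount_pos b)

section Subspaces

variable {V : Type*} [AddCommGroup V] [Module (ZMod 2) V] [Finite V]

theorem card_linIndep (b : ℕ) :
    Nat.card {s : Fin b → V // LinearIndependent (ZMod 2) s}
      = injCount (Module.finrank (ZMod 2) V) b := by
  have : Fintype V := Fintype.ofFinite V
  by_cases h : b ≤ Module.finrank (ZMod 2) V
  · rw [card_linearIndependent h, injCount_eq_prod, ZMod.card]
  · rw [injCount_eq_zero (by omega), Nat.card_eq_zero]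
    left
    refine ⟨fun s => h ?_⟩
    simpa using s.2.fintype_card_le_finrank

noncomputable def linIndepEquiv (b : ℕ) :
    {s : Fin b → V // LinearIndependent (ZMod 2) s} ≃
      Σ T : {T : Submodule (ZMod 2) V // Module.finrank (ZMod 2) T = b},
        {s : Fin b → T.1 // LinearIndependent (ZMod 2) s} where
  toFun s := ⟨⟨Submodule.span (ZMod 2) (Set.range s.1), by
      simpa using finrank_span_eq_card s.2⟩,
    ⟨fun i => ⟨s.1 i, Submodule.subset_span ⟨i, rfl⟩⟩, by
      apply LinearIndependent.of_comp (Submodule.subtype _)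
      exact s.2⟩⟩
  invFun p := ⟨fun i => (p.2.1 i : V), p.2.2.map' (Submodule.subtype _) (Submodule.ker_subtype _)⟩
  left_inv s := rfl
  right_inv := by
    rintro ⟨⟨T, hT⟩, ⟨s, hs⟩⟩
    have key : Submodule.span (ZMod 2) (Set.range fun i => (s i : V)) = T := by
      apply Submodule.eq_of_le_of_finrank_eq
      · rw [Submodule.span_le]
        rintro _ ⟨i, rfl⟩
        exact (s i).2
      · have : LinearIndependent (ZMod 2) (fun i => (s i : V)) :=
          hs.map' (Submodule.subtype _) (Submodule.ker_subtype _)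
        rw [hT]
        simpa using finrank_span_eq_card this
    refine Sigma.ext (Subtype.ext key) ?_
    have aux : ∀ (T' : Submodule (ZMod 2) V) (hT' : Module.finrank (ZMod 2) T' = b)
        (s' : Fin b → T') (hs' : LinearIndependent (ZMod 2) s'), T' = T →
        (∀ i, (s' i : V) = s i) →
        HEq (⟨s', hs'⟩ : {s : Fin b → T' // LinearIndependent (ZMod 2) s})
          (⟨s, hs⟩ : {s : Fin b → T // LinearIndependent (ZMod 2) s}) := by
      intro T' hT' s' hs' h hi
      subst h
      have : s' = s := funext fun i => Subtype.ext (hi i)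
      subst this
      rfl
    exact aux _ ((congrArg (fun S : Submodule (ZMod 2) V => Module.finrank (ZMod 2) S) key).trans hT)
      _ _ key (fun i => rfl)

theorem card_subspaces (b : ℕ) :
    Nat.card {T : Submodule (ZMod 2) V // Module.finrank (ZMod 2) T = b}
      = qbin (Module.finrank (ZMod 2) V) b := by
  have h := Nat.card_congr (linIndepEquiv (V := V) b)
  have : Fintype {T : Submodule (ZMod 2) V // Module.finrank (ZMod 2) T = b} :=
    Fintype.ofFinite _
  rw [card_linIndep, Nat.card_sigma] at h
  rw [Finset.sum_congr rfl (g := fun _ => injCount b b)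
    (fun T _ => by rw [card_linIndep, T.2])] at h
  rw [qbin, h, Finset.sum_const, smul_eq_mul, Nat.mul_div_cancel _ (injCount_pos b),
    Finset.card_univ, Nat.card_eq_fintype_card]

theorem card_subspaces_le (U : Submodule (ZMod 2) V) (b : ℕ) :
    Nat.card {T : Submodule (ZMod 2) V // Module.finrank (ZMod 2) T = b ∧ T ≤ U}
      = qbin (Module.finrank (ZMod 2) U) b := by
  rw [← card_subspaces]
  refine (Nat.card_congr ?_).symm
  refine ⟨fun T => ⟨T.1.map U.subtype, ?_, Submodule.map_subtype_le _ _⟩,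
    fun T => ⟨T.1.comap U.subtype, ?_⟩, ?_, ?_⟩
  · refine Eq.trans ?_ T.2
    exact (Submodule.equivMapOfInjective _ U.injective_subtype _).finrank_eq.symm
  · refine Eq.trans ?_ T.2.1
    exact (Submodule.comapSubtypeEquivOfLe T.2.2).finrank_eq
  · intro T
    exact Subtype.ext (Submodule.comap_map_eq_of_injective U.injective_subtype _)
  · intro T
    apply Subtype.ext
    simp [Submodule.map_comap_subtype, T.2.2]

/-- number of `t`-dimensional subspaces of an `M`-dimensional space containing a given
`e`-dimensional one -/
def upCount (M e t : ℕ) : ℕ := if e ≤ t then qbin (M - e) (t - e) else 0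

theorem finrank_comap_mkQ (S : Submodule (ZMod 2) V) (T : Submodule (ZMod 2) (V ⧸ S)) :
    Module.finrank (ZMod 2) (T.comap S.mkQ)
      = Module.finrank (ZMod 2) T + Module.finrank (ZMod 2) S := by
  have h1 := (T.comap S.mkQ).finrank_quotient_add_finrank
  have h2 := T.finrank_quotient_add_finrank
  have h3 := S.finrank_quotient_add_finrank
  have h4 : Module.finrank (ZMod 2) (V ⧸ T.comap S.mkQ)
      = Module.finrank (ZMod 2) ((V ⧸ S) ⧸ T) := by
    have := (Submodule.quotientQuotientEquivQuotient S (T.comap S.mkQ)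
      (Submodule.le_comap_mkQ S T)).finrank_eq
    rw [← this, Submodule.map_comap_eq_self (by simp)]
  omega

theorem card_subspaces_ge (S : Submodule (ZMod 2) V) (t : ℕ) :
    Nat.card {T : Submodule (ZMod 2) V // Module.finrank (ZMod 2) T = t ∧ S ≤ T}
      = upCount (Module.finrank (ZMod 2) V) (Module.finrank (ZMod 2) S) t := by
  unfold upCount
  split_ifs with h
  · have h3 := S.finrank_quotient_add_finrank
    have : Finite (V ⧸ S) := Finite.of_surjective _ S.mkQ_surjective
    rw [show Module.finrank (ZMod 2) V - Module.finrank (ZMod 2) S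
      = Module.finrank (ZMod 2) (V ⧸ S) by omega, ← card_subspaces]
    refine (Nat.card_congr ?_).symm
    refine ⟨fun T => ⟨T.1.comap S.mkQ, ?_, Submodule.le_comap_mkQ S _⟩,
      fun T => ⟨T.1.map S.mkQ, ?_⟩, ?_, ?_⟩
    · rw [finrank_comap_mkQ, T.2]; omega
    · have := finrank_comap_mkQ S (T.1.map S.mkQ)
      rw [Submodule.comap_map_mkQ, sup_eq_right.2 T.2.2, T.2.1] at this
      omega
    · intro T
      exact Subtype.ext (Submodule.map_comap_eq_self (by simp))
    · intro T
      apply Subtype.ext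
      simp only [Submodule.comap_map_mkQ]
      exact sup_eq_right.2 T.2.2
  · rw [Nat.card_eq_zero]
    left
    refine ⟨fun T => h ?_⟩
    rw [← T.2.1]
    exact Submodule.finrank_mono T.2.2

/-- number of maps with given kernel -/
theorem card_ker_eq (T : Submodule (ZMod 2) V) (n : ℕ) :
    Nat.card {f : V →ₗ[ZMod 2] (Fin n → ZMod 2) // LinearMap.ker f = T}
      = injCount n (Module.finrank (ZMod 2) V - Module.finrank (ZMod 2) T) := by
  have h3 := T.finrank_quotient_add_finrank
  rw [show Module.finrank (ZMod 2) V - Module.finrank (ZMod 2) T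
      = Module.finrank (ZMod 2) (V ⧸ T) by omega]
  have h := card_linIndep (V := Fin n → ZMod 2) (Module.finrank (ZMod 2) (V ⧸ T))
  rw [Module.finrank_fin_fun] at h
  rw [← h]
  let B := Module.finBasis (ZMod 2) (V ⧸ T)
  have hB : ∀ g : (V ⧸ T) →ₗ[ZMod 2] (Fin n → ZMod 2),
      LinearIndependent (ZMod 2) (fun i => g (B i)) ↔ LinearMap.ker g = ⊥ := by
    intro g
    constructor
    · intro hl
      rw [LinearMap.ker_eq_bot']
      intro x hx
      have h1 := B.sum_repr x
      rw [← h1, map_sum] at hx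
      simp only [map_smul] at hx
      have := Fintype.linearIndependent_iff.1 hl _ hx
      rw [← h1]
      simp [this]
    · intro hk
      exact B.linearIndependent.map' g hk
  refine Nat.card_congr ⟨fun f => ⟨fun i => T.liftQ f.1 f.2.ge (B i), ?_⟩,
    fun s => ⟨(B.constr (ZMod 2) s.1).comp T.mkQ, ?_⟩, ?_, ?_⟩
  · rw [hB]
    exact Submodule.ker_liftQ_eq_bot _ _ _ f.2.le
  · rw [LinearMap.ker_comp, (hB (B.constr (ZMod 2) s.1)).1, Submodule.comap_bot,
      Submodule.ker_mkQ]
    simpa using s.2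
  · intro f
    apply Subtype.ext
    ext v
    have : B.constr (ZMod 2) (fun i => T.liftQ f.1 f.2.ge (B i)) = T.liftQ f.1 f.2.ge :=
      B.ext fun i => by simp
    simp only [this]
    simp
  · intro s
    apply Subtype.ext
    funext i
    have : T.liftQ ((B.constr (ZMod 2) s.1).comp T.mkQ)
      (by rw [LinearMap.ker_comp]; exact Submodule.le_comap_mkQ T _) = B.constr (ZMod 2) s.1 := by
      ext v; simp
    simp only [this]
    simp

end Subspaces

/-- append a zero -/
def padA (m : ℕ) : (Fin m → ZMod 2) →ₗ[ZMod 2] (Fin (m + 1) → ZMod 2) where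
  toFun v i := if h : i.val < m then v ⟨i.val, h⟩ else 0
  map_add' u v := by ext i; dsimp; split_ifs <;> simp
  map_smul' c v := by ext i; dsimp; split_ifs <;> simp

/-- prepend a zero -/
def padB (m : ℕ) : (Fin m → ZMod 2) →ₗ[ZMod 2] (Fin (m + 1) → ZMod 2) where
  toFun v i := if h : 0 < i.val then v ⟨i.val - 1, by omega⟩ else 0
  map_add' u v := by ext i; dsimp; split_ifs <;> simp
  map_smul' c v := by ext i; dsimp; split_ifs <;> simp

theorem padA_castSucc {m : ℕ} (v : Fin m → ZMod 2) (i : Fin m) : padA m v i.castSucc = v i := by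
  simp [padA]

theorem padA_last {m : ℕ} (v : Fin m → ZMod 2) : padA m v (Fin.last m) = 0 := by
  simp [padA]

theorem padB_succ {m : ℕ} (v : Fin m → ZMod 2) (i : Fin m) : padB m v i.succ = v i := by
  simp [padB]

theorem padB_zero {m : ℕ} (v : Fin m → ZMod 2) : padB m v 0 = 0 := by
  simp [padB]

theorem padA_inj (m : ℕ) : Function.Injective (padA m) := fun u v h => by
  ext i
  rw [← padA_castSucc u, h, padA_castSucc]

theorem padB_inj (m : ℕ) : Function.Injective (padB m) := fun u v h => by
  ext i
  rw [← padB_succ u, h, padB_succ]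

theorem padA_padB {m : ℕ} (v : Fin m → ZMod 2) :
    padA (m + 1) (padB m v) = padB (m + 1) (padA m v) := by
  ext i
  simp only [padA, padB, LinearMap.coe_mk, AddHom.coe_mk]
  split_ifs <;> first | rfl | omega

theorem pad_pullback {m : ℕ} {w w' : Fin (m + 1) → ZMod 2}
    (h : padA (m + 1) w = padB (m + 1) w') : ∃ u, w = padB m u ∧ w' = padA m u := by
  have h0 : w = padB m (fun i => w i.succ) := by
    ext i
    refine Fin.cases ?_ (fun j => ?_) i
    · rw [padB_zero, ← padA_castSucc w, h]
      exact padB_zero w'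
    · rw [padB_succ]
  refine ⟨_, h0, padB_inj _ ?_⟩
  rw [← h, ← padA_padB, ← h0]

/-- the `v` both of whose paddings lie in `T` -/
def low {m : ℕ} (T : Submodule (ZMod 2) (Fin (m + 1) → ZMod 2)) :
    Submodule (ZMod 2) (Fin m → ZMod 2) := T.comap (padA m) ⊓ T.comap (padB m)

/-- span of both paddings -/
def high {m : ℕ} (W : Submodule (ZMod 2) (Fin m → ZMod 2)) :
    Submodule (ZMod 2) (Fin (m + 1) → ZMod 2) := W.map (padA m) ⊔ W.map (padB m)

theorem high_le_iff {m : ℕ} (W : Submodule (ZMod 2) (Fin m → ZMod 2))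
    (T : Submodule (ZMod 2) (Fin (m + 1) → ZMod 2)) : high W ≤ T ↔ W ≤ low T := by
  rw [high, low, sup_le_iff, le_inf_iff, Submodule.map_le_iff_le_comap,
    Submodule.map_le_iff_le_comap]

theorem finrank_high {m : ℕ} (W : Submodule (ZMod 2) (Fin (m + 1) → ZMod 2)) :
    Module.finrank (ZMod 2) (high W) + Module.finrank (ZMod 2) (low W)
      = 2 * Module.finrank (ZMod 2) W := by
  have h := Submodule.finrank_sup_add_finrank_inf_eq (W.map (padA (m + 1))) (W.map (padB (m + 1)))
  have hA : Module.finrank (ZMod 2) (W.map (padA (m + 1))) = Module.finrank (ZMod 2) W :=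
    (Submodule.equivMapOfInjective _ (padA_inj _) _).finrank_eq.symm
  have hB : Module.finrank (ZMod 2) (W.map (padB (m + 1))) = Module.finrank (ZMod 2) W :=
    (Submodule.equivMapOfInjective _ (padB_inj _) _).finrank_eq.symm
  have hI : W.map (padA (m + 1)) ⊓ W.map (padB (m + 1))
      = (low W).map ((padA (m + 1)).comp (padB m)) := by
    ext x
    simp only [Submodule.mem_inf, Submodule.mem_map, low, Submodule.mem_comap,
      LinearMap.comp_apply]
    constructor
    · rintro ⟨⟨w, hw, rfl⟩, ⟨w', hw', hx⟩⟩
      obtain ⟨u, rfl, rfl⟩ := pad_pullback hx.symm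
      exact ⟨u, ⟨hw', hw⟩, rfl⟩
    · rintro ⟨u, ⟨h1, h2⟩, rfl⟩
      exact ⟨⟨_, h2, rfl⟩, ⟨_, h1, (padA_padB u).symm⟩⟩
  have hL : Module.finrank (ZMod 2) ((low W).map ((padA (m + 1)).comp (padB m)))
      = Module.finrank (ZMod 2) (low W) :=
    (Submodule.equivMapOfInjective ((padA (m + 1)).comp (padB m))
      ((padA_inj _).comp (padB_inj _)) _).finrank_eq.symm
  rw [hI, hL, hA, hB] at h
  rw [high]
  omega

noncomputable def lowCount (m t s : ℕ) : ℕ :=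
  Nat.card {T : Submodule (ZMod 2) (Fin (m + 1) → ZMod 2) //
    Module.finrank (ZMod 2) T = t ∧ Module.finrank (ZMod 2) (low T) = s}

theorem natCard_eq_filter {X : Type*} [Fintype X] (p : X → Prop) [DecidablePred p] :
    Nat.card {x : X // p x} = (Finset.univ.filter p).card := by
  rw [Nat.card_eq_fintype_card, Fintype.card_subtype]

theorem finrank_lt {m N : ℕ} (h : m < N) (T : Submodule (ZMod 2) (Fin m → ZMod 2)) :
    Module.finrank (ZMod 2) T < N := by
  have := T.finrank_le
  rw [Module.finrank_fin_fun] at this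
  omega

theorem sum_by_low {m N : ℕ} (h : m < N) (t : ℕ)
    [Fintype (Submodule (ZMod 2) (Fin (m + 1) → ZMod 2))] (f : ℕ → ℕ) :
    ∑ T ∈ Finset.univ.filter (fun T : Submodule (ZMod 2) (Fin (m + 1) → ZMod 2) =>
        Module.finrank (ZMod 2) T = t),
      f (Module.finrank (ZMod 2) (low T))
      = ∑ s ∈ range N, lowCount m t s * f s := by
  rw [← Finset.sum_fiberwise_of_maps_to (t := range N)
    (g := fun T => Module.finrank (ZMod 2) (low T))
    (fun T _ => Finset.mem_range.2 (finrank_lt h _))]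
  refine Finset.sum_congr rfl fun s _ => ?_
  rw [Finset.sum_congr rfl (g := fun _ => f s) (by
    intro T hT
    rw [(Finset.mem_filter.1 hT).2])]
  rw [Finset.sum_const, smul_eq_mul, lowCount, natCard_eq_filter, Finset.filter_filter]

theorem step_eq {m N : ℕ} (h : m + 1 < N) (t s' : ℕ) :
    ∑ s ∈ range N, lowCount (m + 1) t s * qbin s s'
      = ∑ b ∈ range N, lowCount m s' b * upCount (m + 2) (2 * s' - b) t := by
  classical
  have : Fintype (Submodule (ZMod 2) (Fin (m + 1) → ZMod 2)) := Fintype.ofFinite _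
  have : Fintype (Submodule (ZMod 2) (Fin (m + 1 + 1) → ZMod 2)) := Fintype.ofFinite _
  rw [← sum_by_low h t (fun s => qbin s s'),
    ← sum_by_low (by omega : m < N) s' (fun b => upCount (m + 2) (2 * s' - b) t)]
  have key := Finset.sum_card_bipartiteAbove_eq_sum_card_bipartiteBelow
    (s := Finset.univ.filter fun T : Submodule (ZMod 2) (Fin (m + 1 + 1) → ZMod 2) =>
      Module.finrank (ZMod 2) T = t)
    (t := Finset.univ.filter fun W : Submodule (ZMod 2) (Fin (m + 1) → ZMod 2) =>
      Module.finrank (ZMod 2) W = s')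
    (fun T W => high W ≤ T)
  refine Eq.trans ?_ (key.trans ?_)
  · refine Finset.sum_congr rfl fun T hT => ?_
    rw [← card_subspaces_le, natCard_eq_filter, Finset.bipartiteAbove, Finset.filter_filter]
    simp only [high_le_iff]
  · refine Finset.sum_congr rfl fun W hW => ?_
    have hW' := (Finset.mem_filter.1 hW).2
    have e := finrank_high W
    have := card_subspaces_ge (high W) t
    rw [natCard_eq_filter, Module.finrank_fin_fun,
      show Module.finrank (ZMod 2) (high W) = 2 * s' - Module.finrank (ZMod 2) (low W) by omega]
      at this
    rw [← this, Finset.bipartiteBelow, Finset.filter_filter]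

theorem triangular {N : ℕ} (f g : ℕ → ℕ)
    (h : ∀ s' < N, ∑ s ∈ range N, f s * qbin s s' = ∑ s ∈ range N, g s * qbin s s') :
    ∀ s < N, f s = g s := by
  have main : ∀ d s, s < N → N - s ≤ d → f s = g s := by
    intro d
    induction d with
    | zero => intro s hs hd; omega
    | succ d ih =>
      intro s hs hd
      have h1 := h s hs
      rw [← Finset.add_sum_erase _ _ (Finset.mem_range.2 hs),
        ← Finset.add_sum_erase _ (fun x => g x * qbin x s) (Finset.mem_range.2 hs),
        qbin_self] at h1
      have h2 : ∑ x ∈ (range N).erase s, f x * qbin x s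
          = ∑ x ∈ (range N).erase s, g x * qbin x s := by
        refine Finset.sum_congr rfl fun x hx => ?_
        rw [Finset.mem_erase, Finset.mem_range] at hx
        rcases lt_or_gt_of_ne hx.1 with hlt | hgt
        · rw [qbin_eq_zero hlt]; simp
        · rw [ih x hx.2 (by omega)]
      rw [h2] at h1
      simpa using h1
  exact fun s hs => main N s hs (by omega)

def look (T : List (List ℕ)) (t s : ℕ) : ℕ := (T.getD t []).getD s 0

def stepOk (m : ℕ) (T T' : List (List ℕ)) : Bool :=
  (List.range 12).all fun t => (List.range 12).all fun s' =>
    ((List.range 12).map fun s => look T' t s * qbin s s').sum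
      == ((List.range 12).map fun b => look T s' b * upCount (m + 2) (2 * s' - b) t).sum

theorem sum_range_list (N : ℕ) (f : ℕ → ℕ) : ∑ s ∈ range N, f s = ((List.range N).map f).sum := by
  induction N with
  | zero => simp
  | succ N ih => rw [Finset.sum_range_succ, List.range_succ, ih]; simp

def Good (m : ℕ) (T : List (List ℕ)) : Prop :=
  ∀ t < 12, ∀ s < 12, lowCount m t s = look T t s

theorem good_step {m : ℕ} {T T' : List (List ℕ)} (hT : Good m T) (hm : m + 1 < 12)
    (h : stepOk m T T' = true) : Good (m + 1) T' := by
  intro t ht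
  refine triangular _ _ fun s' hs' => ?_
  rw [step_eq hm]
  have h1 := List.all_eq_true.1 (List.all_eq_true.1 h t (List.mem_range.2 ht)) s'
    (List.mem_range.2 hs')
  rw [beq_iff_eq, ← sum_range_list, ← sum_range_list] at h1
  rw [h1]
  refine Finset.sum_congr rfl fun b hb => ?_
  rw [hT s' hs' b (Finset.mem_range.1 hb)]

theorem good_zero : Good 0 [[1], [1]] := by
  have hlow : ∀ T : Submodule (ZMod 2) (Fin (0 + 1) → ZMod 2),
      Module.finrank (ZMod 2) (low T) = 0 := by
    intro T
    have := finrank_lt (show 0 < 1 by norm_num) (low T)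
    omega
  have h1 : ∀ t s, lowCount 0 t s = if s = 0 then qbin 1 t else 0 := by
    intro t s
    unfold lowCount
    simp only [hlow]
    split_ifs with h
    · subst h
      have := card_subspaces (V := Fin (0 + 1) → ZMod 2) t
      rw [Module.finrank_fin_fun] at this
      simpa using this
    · rw [Nat.card_eq_zero]
      left
      exact ⟨fun T => h T.2.2.symm⟩
  have h2 : (List.range 12).all (fun t => (List.range 12).all fun s =>
      (if s = 0 then qbin 1 t else 0) == look [[1], [1]] t s) = true := by decide +kernel
  intro t ht s hs
  rw [h1]
  simpa using List.all_eq_true.1 (List.all_eq_true.1 h2 t (List.mem_range.2 ht)) s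
    (List.mem_range.2 hs)

theorem good_ten : Good 10 
   [[1],
    [2047],
    [697004, 1023],
    [50434240, 521220, 511],
    [822423552, 43525440, 302260, 255],
    [2796552192, 725667840, 26456640, 160020, 127],
    [1073741824, 2047868928, 413306880, 13838400, 80724, 63],
    [0, 0, 682622976, 177131520, 6457920, 39060, 31],
    [0, 0, 0, 0, 48377856, 2560320, 17780, 15],
    [0, 0, 0, 0, 0, 0, 690880, 7140, 7],
    [0, 0, 0, 0, 0, 0, 0, 0, 2044, 3],
    [0, 0, 0, 0, 0, 0, 0, 0, 0, 0, 1]] := by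
  have g1 : Good 1 
   [[1],
    [3],
    [0, 1]] :=
    good_step good_zero (by norm_num) (by decide +kernel)
  have g2 : Good 2 
   [[1],
    [7],
    [4, 3],
    [0, 0, 1]] :=
    good_step g1 (by norm_num) (by decide +kernel)
  have g3 : Good 3 
   [[1],
    [15],
    [28, 7],
    [0, 12, 3],
    [0, 0, 0, 1]] :=
    good_step g2 (by norm_num) (by decide +kernel)
  have g4 : Good 4 
   [[1],
    [31],
    [140, 15],
    [64, 84, 7],
    [0, 0, 28, 3],
    [0, 0, 0, 0, 1]] :=
    good_step g3 (by norm_num) (by decide +kernel)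
  have g5 : Good 5 
   [[1],
    [63],
    [620, 31],
    [960, 420, 15],
    [0, 448, 196, 7],
    [0, 0, 0, 60, 3],
    [0, 0, 0, 0, 0, 1]] :=
    good_step g4 (by norm_num) (by decide +kernel)
  have g6 : Good 6 
   [[1],
    [127],
    [2604, 63],
    [9920, 1860, 31],
    [4096, 6720, 980, 15],
    [0, 0, 2240, 420, 7],
    [0, 0, 0, 0, 124, 3],
    [0, 0, 0, 0, 0, 0, 1]] :=
    good_step g5 (by norm_num) (by decide +kernel)
  have g7 : Good 7 
   [[1],
    [255],
    [10668, 127],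
    [89280, 7812, 63],
    [126976, 69440, 4340, 31],
    [0, 61440, 33600, 2100, 15],
    [0, 0, 0, 9920, 868, 7],
    [0, 0, 0, 0, 0, 252, 3],
    [0, 0, 0, 0, 0, 0, 0, 1]] :=
    good_step g6 (by norm_num) (by decide +kernel)
  have g8 : Good 8 
   [[1],
    [511],
    [43180, 255],
    [755904, 32004, 127],
    [2666496, 624960, 18228, 63],
    [1048576, 1904640, 347200, 9300, 31],
    [0, 0, 634880, 148800, 4340, 15],
    [0, 0, 0, 0, 41664, 1764, 7],
    [0, 0, 0, 0, 0, 0, 508, 3],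
    [0, 0, 0, 0, 0, 0, 0, 0, 1]] :=
    good_step g7 (by norm_num) (by decide +kernel)
  have g9 : Good 9 
   [[1],
    [1023],
    [173740, 511],
    [6217920, 129540, 255],
    [48377856, 5291328, 74676, 127],
    [66060288, 39997440, 3124800, 39060, 63],
    [0, 32505856, 19681280, 1537600, 19220, 31],
    [0, 0, 0, 5713920, 624960, 8820, 15],
    [0, 0, 0, 0, 0, 170688, 3556, 7],
    [0, 0, 0, 0, 0, 0, 0, 1020, 3],
    [0, 0, 0, 0, 0, 0, 0, 0, 0, 1]] :=
    good_step g8 (by norm_num) (by decide +kernel)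
  exact good_step g9 (by norm_num) (by decide +kernel)

theorem persym_rank_iff (n : ℕ) (α : Fin n → Fin (10 + 1) → ZMod 2) :
    (persymMatrix n 10 α).rank = 10 ↔
      Module.finrank (ZMod 2) (low (LinearMap.ker (Matrix.mulVecLin (Matrix.of α)))) = 0 := by
  have hker : LinearMap.ker (persymMatrix n 10 α).mulVecLin
      = low (LinearMap.ker (Matrix.mulVecLin (Matrix.of α))) := by
    have hA : ∀ (v : Fin 10 → ZMod 2) (j : Fin n), (Matrix.of α).mulVec (padA 10 v) j
        = ∑ c : Fin 10, α j c.castSucc * v c := by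
      intro v j
      rw [Matrix.mulVec, dotProduct, Fin.sum_univ_castSucc]
      rw [padA_last, mul_zero, add_zero]
      simp only [padA_castSucc, Matrix.of_apply]
    have hB : ∀ (v : Fin 10 → ZMod 2) (j : Fin n), (Matrix.of α).mulVec (padB 10 v) j
        = ∑ c : Fin 10, α j c.succ * v c := by
      intro v j
      rw [Matrix.mulVec, dotProduct, Fin.sum_univ_succ]
      simp [padB_succ, padB_zero]
    have hP : ∀ (v : Fin 10 → ZMod 2) (r : Fin (2 * n)), (persymMatrix n 10 α).mulVec v r
        = ∑ c : Fin 10, α ⟨r.val / 2, by omega⟩ ⟨r.val % 2 + c.val, by omega⟩ * v c := by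
      intro v r
      rfl
    ext v
    simp only [low, Submodule.mem_inf, Submodule.mem_comap, LinearMap.mem_ker,
      Matrix.mulVecLin_apply]
    constructor
    · intro h
      constructor
      · ext j
        rw [hA]
        have := congrFun h ⟨2 * j.val, by omega⟩
        rw [hP] at this
        simp only [Pi.zero_apply] at this ⊢
        rw [← this]
        refine Finset.sum_congr rfl fun c _ => ?_
        congr 2
        · congr 1; ext; simp
        · ext; simp
      · ext j
        rw [hB]
        have := congrFun h ⟨2 * j.val + 1, by omega⟩
        rw [hP] at this
        simp only [Pi.zero_apply] at this ⊢
        rw [← this]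
        refine Finset.sum_congr rfl fun c _ => ?_
        congr 2
        · congr 1; ext; simp; omega
        · ext; simp; omega
    · rintro ⟨h1, h2⟩
      ext r
      rw [hP]
      rcases Nat.mod_two_eq_zero_or_one r.val with hr | hr
      · have := congrFun h1 ⟨r.val / 2, by omega⟩
        rw [hA] at this
        refine Eq.trans ?_ this
        refine Finset.sum_congr rfl fun c _ => ?_
        congr 2
        ext; simp [hr]
      · have := congrFun h2 ⟨r.val / 2, by omega⟩
        rw [hB] at this
        refine Eq.trans ?_ this
        refine Finset.sum_congr rfl fun c _ => ?_
        congr 2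
        ext; simp [hr]; omega
  have hrn := LinearMap.finrank_range_add_finrank_ker (persymMatrix n 10 α).mulVecLin
  rw [Module.finrank_fin_fun, hker] at hrn
  rw [Matrix.rank]
  omega

theorem Gamma_eq_sum (n : ℕ) :
    Gamma n 10 10 = ∑ t ∈ range 12, lowCount 10 t 0 * injCount n (11 - t) := by
  classical
  have : Fintype (Submodule (ZMod 2) (Fin (10 + 1) → ZMod 2)) := Fintype.ofFinite _
  have : Fintype ((Fin (10 + 1) → ZMod 2) →ₗ[ZMod 2] (Fin n → ZMod 2)) :=
    have := Finite.of_injective (fun f : (Fin (10 + 1) → ZMod 2) →ₗ[ZMod 2] (Fin n → ZMod 2) =>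
      (f : (Fin (10 + 1) → ZMod 2) → (Fin n → ZMod 2))) DFunLike.coe_injective
    Fintype.ofFinite _
  have h1 : Gamma n 10 10 = Nat.card {f : (Fin (10 + 1) → ZMod 2) →ₗ[ZMod 2] (Fin n → ZMod 2) //
      Module.finrank (ZMod 2) (low (LinearMap.ker f)) = 0} := by
    unfold Gamma
    refine Nat.card_congr (Equiv.subtypeEquiv
      (Matrix.toLin' (R := ZMod 2) (m := Fin n) (n := Fin (10 + 1))).toEquiv fun α => ?_)
    rw [persym_rank_iff]
    rfl
  rw [h1, natCard_eq_filter,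
    Finset.card_eq_sum_card_fiberwise (f := fun f => LinearMap.ker f)
      (t := Finset.univ.filter fun T : Submodule (ZMod 2) (Fin (10 + 1) → ZMod 2) =>
        Module.finrank (ZMod 2) (low T) = 0) (by intro f hf; simpa using hf)]
  have h2 : ∀ T ∈ Finset.univ.filter (fun T : Submodule (ZMod 2) (Fin (10 + 1) → ZMod 2) =>
        Module.finrank (ZMod 2) (low T) = 0),
      (Finset.filter (fun f => LinearMap.ker f = T) (Finset.univ.filter
        fun f : (Fin (10 + 1) → ZMod 2) →ₗ[ZMod 2] (Fin n → ZMod 2) =>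
          Module.finrank (ZMod 2) (low (LinearMap.ker f)) = 0)).card
        = injCount n (11 - Module.finrank (ZMod 2) T) := by
    intro T hT
    have := card_ker_eq T n
    rw [Module.finrank_fin_fun, natCard_eq_filter] at this
    rw [← this, Finset.filter_filter]
    congr 1
    ext f
    simp only [Finset.mem_filter, Finset.mem_univ, true_and]
    constructor
    · exact fun h => h.2
    · rintro rfl
      exact ⟨(Finset.mem_filter.1 hT).2, rfl⟩
  rw [Finset.sum_congr rfl h2]
  rw [← Finset.sum_fiberwise_of_maps_to (t := range 12)
    (g := fun T : Submodule (ZMod 2) (Fin (10 + 1) → ZMod 2) => Module.finrank (ZMod 2) T)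
    (fun T _ => Finset.mem_range.2 (finrank_lt (by norm_num) _))]
  refine Finset.sum_congr rfl fun t _ => ?_
  rw [Finset.sum_congr rfl (g := fun _ => injCount n (11 - t)) (by
    intro T hT
    rw [(Finset.mem_filter.1 hT).2])]
  rw [Finset.sum_const, smul_eq_mul, lowCount, natCard_eq_filter, Finset.filter_filter]
  congr 2
  ext T
  simp [and_comm]

/-- integer version of `injCount` -/
def injInt (x : ℤ) : ℕ → ℤ
  | 0 => 1
  | b + 1 => injInt x b * (x - 2 ^ b)

theorem injInt_eq (n b : ℕ) : (injCount n b : ℤ) = injInt (2 ^ n) b := by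
  induction b with
  | zero => simp [injCount, injInt]
  | succ b ih =>
    rw [injInt, ← ih, injCount]
    by_cases h : b ≤ n
    · have := Nat.pow_le_pow_right (n := 2) (by norm_num) h
      push_cast [Nat.cast_sub this]
      ring
    · rw [injCount_eq_zero (by omega)]
      simp

theorem gamma_ten_k_ten (n : ℕ) (hn : 5 ≤ n) :
    (Gamma n 10 10 : ℤ) =
      2 ^ (11 * n) - 1023 * 2 ^ (9 * n) + 1022 * 2 ^ (8 * n) + 345440 * 2 ^ (7 * n)
        - 1028192 * 2 ^ (6 * n) - 45028608 * 2 ^ (5 * n) + 299663360 * 2 ^ (4 * n)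
        + 494731264 * 2 ^ (3 * n) - 27432 * 2 ^ 18 * 2 ^ (2 * n)
        + 57344 * 2 ^ 18 * 2 ^ n - 256 * 2 ^ 25 := by
  have h : ∀ t < 12, lowCount 10 t 0 = _ := fun t ht => good_ten t ht 0 (by norm_num)
  rw [Gamma_eq_sum, Finset.sum_congr rfl fun t ht => by rw [h t (Finset.mem_range.1 ht)]]
  simp only [Finset.sum_range_succ, Finset.sum_range_zero, look, List.getD_cons_zero,
    List.getD_cons_succ, List.getD_nil]
  push_cast [injInt_eq]
  simp only [injInt, Nat.reduceSub, pow_mul']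
  generalize (2 : ℤ) ^ n = x
  ring
end

section
/- For every integer n ≥ 1, the number of tuples (Y_1, Y_2, Y_3, Y_4, (U_j^{(i)})_{1≤j≤n, 1≤i≤4}) of polynomials over 𝔽₂ with deg Y_i ≤ 9 and deg U_j^{(i)} ≤ 1 for all i, j, and Σ_{i=1}^4 Y_i·U_j^{(i)} = 0 in 𝔽₂[T] for every j = 1,…,n, equals 2^{8n} + 15345·2^{6n} + 107310·2^{5n} + 37128000·2^{4n} + 329001120·2^{3n} + 67088385·2^8·2^{2n} + 26043255·2^{12}·2^n + 14881860·2^{16}. -/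
open Finset
open Module Polynomial

abbrev Ftwo := ZMod 2

/-- Gaussian binomial coefficient at two. -/
def gb (n d : ℕ) : ℕ :=
  (∏ i : Fin d, (2 ^ n - 2 ^ i.val)) / (∏ i : Fin d, (2 ^ d - 2 ^ i.val))

theorem den_pos (d : ℕ) : 0 < ∏ i : Fin d, (2 ^ d - 2 ^ i.val) := by
  apply Finset.prod_pos
  intro i _
  have : 2 ^ i.val < 2 ^ d := Nat.pow_lt_pow_right (by norm_num) i.2
  omega

section general
variable {V : Type} [AddCommGroup V] [Module Ftwo V]

/-- tuples in a subspace versus tuples in the space -/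
theorem card_basis_fibre [Finite V] (d : ℕ) (W : Submodule Ftwo V) (hW : finrank Ftwo W = d) :
    Nat.card {s : {s : Fin d → V // LinearIndependent Ftwo s} //
      Submodule.span Ftwo (Set.range s.1) = W} = ∏ i : Fin d, (2 ^ d - 2 ^ i.val) := by
  have h := card_linearIndependent (K := Ftwo) (V := W) (k := d) hW.ge
  rw [hW, ZMod.card] at h
  rw [← h]
  refine Nat.card_congr
    { toFun := fun s => ⟨fun i => ⟨s.1.1 i, by
          exact s.2.le (Submodule.subset_span ⟨i, rfl⟩)⟩, ?_⟩
      invFun := fun s => ⟨⟨fun i => (s.1 i : V), ?_⟩, ?_⟩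
      left_inv := ?_
      right_inv := ?_ }
  · apply LinearIndependent.of_comp W.subtype
    exact s.1.2
  · exact (LinearMap.linearIndependent_iff W.subtype (Submodule.ker_subtype W)).2 s.2
  · have hli : LinearIndependent Ftwo (fun i => (s.1 i : V)) :=
      (LinearMap.linearIndependent_iff W.subtype (Submodule.ker_subtype W)).2 s.2
    apply Submodule.eq_of_le_of_finrank_eq
    · rw [Submodule.span_le]
      rintro _ ⟨i, rfl⟩
      exact (s.1 i).2
    · rw [finrank_span_eq_card hli, hW, Fintype.card_fin]
  · intro s; rfl
  · intro s; rfl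

theorem card_sub [Finite V] (d : ℕ) :
    Nat.card {W : Submodule Ftwo V // finrank Ftwo W = d} = gb (finrank Ftwo V) d := by
  by_cases hd : d ≤ finrank Ftwo V
  · have h := card_linearIndependent (K := Ftwo) (V := V) (k := d) hd
    rw [ZMod.card] at h
    rw [gb, ← h]
    symm
    apply Nat.div_eq_of_eq_mul_left (den_pos d)
    let f : {s : Fin d → V // LinearIndependent Ftwo s} →
        {W : Submodule Ftwo V // finrank Ftwo W = d} :=
      fun s => ⟨Submodule.span Ftwo (Set.range s.1), by
        rw [finrank_span_eq_card s.2, Fintype.card_fin]⟩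
    have : Fintype {W : Submodule Ftwo V // finrank Ftwo W = d} := Fintype.ofFinite _
    rw [← Nat.card_congr (Equiv.sigmaFiberEquiv f), Nat.card_sigma]
    have hf : ∀ W : {W : Submodule Ftwo V // finrank Ftwo W = d},
        Nat.card {s // f s = W} = ∏ i : Fin d, (2 ^ d - 2 ^ i.val) := by
      intro W
      rw [← card_basis_fibre d W.1 W.2]
      apply Nat.card_congr
      apply Equiv.subtypeEquivRight
      intro s
      exact Subtype.ext_iff
    simp only [hf]
    simp
  · have h0 : gb (finrank Ftwo V) d = 0 := by
      rw [gb, Finset.prod_eq_zero (i := ⟨finrank Ftwo V, by omega⟩) (Finset.mem_univ _) (by simp)]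
      simp
    rw [h0]
    have : IsEmpty {W : Submodule Ftwo V // finrank Ftwo W = d} := by
      constructor
      rintro ⟨W, hW⟩
      have := Submodule.finrank_le W
      omega
    simp

theorem card_below (C : Submodule Ftwo V) [Finite C] (d : ℕ) :
    Nat.card {W : Submodule Ftwo V // W ≤ C ∧ finrank Ftwo W = d} = gb (finrank Ftwo C) d := by
  rw [← card_sub]
  symm
  refine Nat.card_congr (((Submodule.mapIic C).toEquiv.subtypeEquiv
      (p := fun W : Submodule Ftwo C => finrank Ftwo W = d)
      (q := fun W : Set.Iic C => finrank Ftwo (W.1 : Submodule Ftwo V) = d) ?_).trans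
    (Equiv.subtypeSubtypeEquivSubtypeInter (fun W => W ≤ C) (fun W => finrank Ftwo W = d)))
  intro W
  change _ ↔ finrank Ftwo (Submodule.map C.subtype W) = d
  rw [Submodule.finrank_map_subtype_eq]

theorem card_between (S C : Submodule Ftwo V) [Finite C] (hSC : S ≤ C) (w : ℕ)
    (hw : finrank Ftwo S ≤ w) :
    Nat.card {W : Submodule Ftwo V // (S ≤ W ∧ W ≤ C) ∧ finrank Ftwo W = w} =
      gb (finrank Ftwo C - finrank Ftwo S) (w - finrank Ftwo S) := by
  obtain ⟨D0, hD0⟩ := exists_isCompl S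
  set D := D0 ⊓ C with hD
  have hDC : D ≤ C := inf_le_right
  have hsup : D ⊔ S = C := by
    rw [sup_comm, hD, ← sup_inf_assoc_of_le D0 hSC, hD0.sup_eq_top, top_inf_eq]
  have hinf : D ⊓ S = ⊥ := by
    rw [eq_bot_iff, ← hD0.inf_eq_bot, inf_comm S]
    exact inf_le_inf_right _ inf_le_left
  have : Finite D := Finite.of_injective _ (Submodule.inclusion_injective hDC)
  have : Finite S := Finite.of_injective _ (Submodule.inclusion_injective hSC)
  have hfr : ∀ W ≤ D, finrank Ftwo (W ⊔ S : Submodule Ftwo V) = finrank Ftwo W + finrank Ftwo S := by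
    intro W hW
    have : Finite W := Finite.of_injective _ (Submodule.inclusion_injective hW)
    have h := Submodule.finrank_sup_add_finrank_inf_eq W S
    have h2 : W ⊓ S = ⊥ := by
      rw [eq_bot_iff, ← hinf]
      exact inf_le_inf_right _ hW
    rw [h2, finrank_bot] at h
    omega
  have hD2 := hfr D le_rfl
  rw [hsup] at hD2
  rw [hD2, Nat.add_sub_cancel, ← card_below]
  symm
  have e := infIccOrderIsoIccSup D S
  refine Nat.card_congr
    { toFun := fun W => ⟨W.1 ⊔ S, ⟨le_sup_right, ?_⟩, ?_⟩
      invFun := fun W => ⟨D ⊓ W.1, inf_le_left, ?_⟩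
      left_inv := ?_
      right_inv := ?_ }
  · rw [← hsup]; exact sup_le_sup_right W.2.1 _
  · rw [hfr _ W.2.1, W.2.2]; omega
  · have h1 : (D ⊓ W.1) ⊔ S = W.1 := by
      rw [sup_comm, inf_comm, inf_comm, ← sup_inf_assoc_of_le D W.2.1.1, sup_comm, hsup]
      exact inf_eq_right.2 W.2.1.2
    have h2 := hfr (D ⊓ W.1) inf_le_left
    rw [h1, W.2.2] at h2
    omega
  · rintro ⟨W, hW, hW'⟩
    apply Subtype.ext
    change D ⊓ (W ⊔ S) = W
    rw [inf_comm, sup_inf_assoc_of_le S hW, inf_comm, hinf, sup_bot_eq]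
  · rintro ⟨W, hW, hW'⟩
    apply Subtype.ext
    change (D ⊓ W) ⊔ S = W
    rw [sup_comm, ← sup_inf_assoc_of_le D hW.1, sup_comm, hsup]
    exact inf_eq_right.2 hW.2

/-- Number of spanning four-tuples of a space of dimension `w`. -/
theorem card_span_coord (w : ℕ) (hw : w ≤ 4) :
    Nat.card {Y : Fin 4 → (Fin w → Ftwo) // Submodule.span Ftwo (Set.range Y) = ⊤} =
      ∏ i : Fin w, (2 ^ 4 - 2 ^ i.val) := by
  have h := card_linearIndependent (K := Ftwo) (V := Fin 4 → Ftwo) (k := w) (by simpa using hw)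
  rw [ZMod.card, finrank_fin_fun] at h
  rw [← h]
  refine Nat.card_congr ((Equiv.piComm (fun (_ : Fin 4) (_ : Fin w) => Ftwo)).subtypeEquiv ?_)
  intro Y
  let A : Matrix (Fin 4) (Fin w) Ftwo := Matrix.of Y
  have h1 := Matrix.rank_eq_finrank_span_row A
  have h2 := Matrix.rank_eq_finrank_span_cols A
  change A.rank = finrank Ftwo (Submodule.span Ftwo (Set.range Y)) at h1
  change A.rank = finrank Ftwo (Submodule.span Ftwo
    (Set.range (Equiv.piComm (fun (_ : Fin 4) (_ : Fin w) => Ftwo) Y))) at h2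
  rw [linearIndependent_iff_card_eq_finrank_span, Set.finrank, ← h2, h1, Fintype.card_fin]
  constructor
  · intro h; rw [h]; simp
  · intro h; apply Submodule.eq_top_of_finrank_eq; rw [← h]; simp

theorem card_span (W : Submodule Ftwo V) [Finite W] (hw : finrank Ftwo W ≤ 4) :
    Nat.card {Y : Fin 4 → V // Submodule.span Ftwo (Set.range Y) = W} =
      ∏ i : Fin (finrank Ftwo W), (2 ^ 4 - 2 ^ i.val) := by
  rw [← card_span_coord _ hw]
  have e : W ≃ₗ[Ftwo] (Fin (finrank Ftwo W) → Ftwo) :=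
    LinearEquiv.ofFinrankEq _ _ (by simp)
  have e1 : {Y : Fin 4 → V // Submodule.span Ftwo (Set.range Y) = W} ≃
      {Y : Fin 4 → W // Submodule.span Ftwo (Set.range Y) = ⊤} :=
    { toFun := fun Y => ⟨fun i => ⟨Y.1 i, by
          exact Y.2.le (Submodule.subset_span ⟨i, rfl⟩)⟩, by
            apply Submodule.map_injective_of_injective W.injective_subtype
            rw [Submodule.map_span, ← Set.range_comp, Submodule.map_top, Submodule.range_subtype]
            exact Y.2⟩
      invFun := fun Y => ⟨fun i => (Y.1 i : V), by
            have := congrArg (Submodule.map W.subtype) Y.2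
            rw [Submodule.map_span, ← Set.range_comp, Submodule.map_top,
              Submodule.range_subtype] at this
            exact this⟩
      left_inv := fun Y => rfl
      right_inv := fun Y => rfl }
  rw [Nat.card_congr e1]
  refine Nat.card_congr ((Equiv.piCongrRight (fun _ : Fin 4 => e.toEquiv)).subtypeEquiv ?_)
  intro Y
  have h3 : Submodule.span Ftwo (Set.range ((Equiv.piCongrRight fun _ : Fin 4 => e.toEquiv) Y)) =
      Submodule.map e.toLinearMap (Submodule.span Ftwo (Set.range Y)) := by
    rw [Submodule.map_span, ← Set.range_comp]
    rfl
  rw [h3]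
  constructor
  · intro h; rw [h, Submodule.map_top]; exact LinearEquiv.range e
  · intro h
    apply Submodule.map_injective_of_injective (f := e.toLinearMap) e.injective
    rw [h, Submodule.map_top]; exact (LinearEquiv.range e).symm

end general

section poly

theorem natCard_coe {α : Type} (s : Finset α) : Nat.card {x // x ∈ s} = s.card := by simp

/-- multiplication by the variable -/
noncomputable def mX : Ftwo[X] →ₗ[Ftwo] Ftwo[X] := LinearMap.mulLeft Ftwo (X : Ftwo[X])

theorem mX_apply (p : Ftwo[X]) : mX p = X * p := rfl

theorem mX_inj : Function.Injective mX := by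
  intro p q h
  exact mul_left_cancel₀ X_ne_zero h

/-- polynomials of degree less than `k` -/
noncomputable abbrev DD (k : ℕ) : Submodule Ftwo Ftwo[X] := degreeLT Ftwo k

instance finite_DD (k : ℕ) : Finite (DD k) :=
  Finite.of_equiv _ (degreeLTEquiv Ftwo k).symm.toEquiv

theorem finrank_DD (k : ℕ) : finrank Ftwo (DD k) = k := by
  rw [(degreeLTEquiv Ftwo k).finrank_eq]; simp

theorem finite_of_le {W C : Submodule Ftwo Ftwo[X]} [Finite C] (h : W ≤ C) : Finite W :=
  Finite.of_injective _ (Submodule.inclusion_injective h)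

/-- the elements of `W` whose shift is in `W` -/
noncomputable def GG (W : Submodule Ftwo Ftwo[X]) : Submodule Ftwo Ftwo[X] := W ⊓ W.comap mX

noncomputable def gg (W : Submodule Ftwo Ftwo[X]) : ℕ := finrank Ftwo (GG W)

theorem mX_mem (k : ℕ) (p : Ftwo[X]) : mX p ∈ DD (k + 1) ↔ p ∈ DD k := by
  rw [mX_apply, mem_degreeLT, mem_degreeLT]
  by_cases hp : p = 0
  · simp [hp]
  · rw [degree_mul, degree_X, degree_eq_natDegree hp]
    norm_cast
    omega

theorem GG_le (k : ℕ) (W : Submodule Ftwo Ftwo[X]) (h : W ≤ DD (k + 1)) : GG W ≤ DD k := by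
  intro p hp
  rw [← mX_mem]
  exact h hp.2

theorem map_mX_le (k : ℕ) (H : Submodule Ftwo Ftwo[X]) (h : H ≤ DD k) :
    H ⊔ H.map mX ≤ DD (k + 1) := by
  apply sup_le
  · intro p hp
    have := h hp
    rw [mem_degreeLT] at this ⊢
    exact this.trans (by norm_cast; omega)
  · rintro _ ⟨p, hp, rfl⟩
    rw [mX_mem]
    exact h hp

theorem finrank_map_mX (H : Submodule Ftwo Ftwo[X]) :
    finrank Ftwo (H.map mX) = finrank Ftwo H :=
  ((Submodule.equivMapOfInjective mX mX_inj H).finrank_eq).symm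

theorem finrank_shift (H : Submodule Ftwo Ftwo[X]) [Finite H] :
    finrank Ftwo (H ⊔ H.map mX : Submodule Ftwo Ftwo[X]) + gg H = 2 * finrank Ftwo H := by
  have : FiniteDimensional Ftwo (H.map mX) := inferInstance
  have h := Submodule.finrank_sup_add_finrank_inf_eq H (H.map mX)
  rw [finrank_map_mX] at h
  have h2 : H ⊓ H.map mX = (GG H).map mX := by
    ext p
    constructor
    · rintro ⟨h1, q, hq, rfl⟩
      exact ⟨q, ⟨hq, h1⟩, rfl⟩
    · rintro ⟨q, hq, rfl⟩
      exact ⟨hq.2, q, hq.1, rfl⟩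
  rw [h2, finrank_map_mX] at h
  rw [gg]; omega

theorem eq_bot_of_GG (k : ℕ) (W : Submodule Ftwo Ftwo[X]) (h : W ≤ DD k) (hW : GG W = W) :
    W = ⊥ := by
  induction k with
  | zero =>
    rw [eq_bot_iff]
    intro p hp
    have := h hp
    rw [mem_degreeLT] at this
    simp only [Nat.cast_zero] at this
    rw [Submodule.mem_bot, ← degree_eq_bot]
    exact Nat.WithBot.lt_zero_iff.1 this
  | succ k ih =>
    apply ih
    rw [← hW]
    exact GG_le k W h

theorem gg_lt (k : ℕ) (W : Submodule Ftwo Ftwo[X]) (h : W ≤ DD k) (hW : 1 ≤ finrank Ftwo W) :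
    gg W < finrank Ftwo W := by
  have : Finite W := finite_of_le h
  by_contra hc
  have hle : GG W ≤ W := inf_le_left
  have h1 : GG W = W := by
    apply Submodule.eq_of_le_of_finrank_le hle
    rw [gg] at hc; omega
  have := eq_bot_of_GG k W h h1
  rw [this, finrank_bot] at hW
  omega

theorem finite_SS (k w : ℕ) :
    {W : Submodule Ftwo Ftwo[X] | W ≤ DD k ∧ finrank Ftwo W = w}.Finite := by
  apply Set.Finite.subset (s := Set.Iic (DD k))
  · exact Set.finite_coe_iff.1 (Finite.of_equiv _ (Submodule.mapIic (DD k)).toEquiv)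
  · intro W h; exact h.1

/-- subspaces of dimension `w` -/
noncomputable def SS (k w : ℕ) : Finset (Submodule Ftwo Ftwo[X]) := (finite_SS k w).toFinset

theorem mem_SS {k w : ℕ} {W : Submodule Ftwo Ftwo[X]} :
    W ∈ SS k w ↔ W ≤ DD k ∧ finrank Ftwo W = w := by
  simp [SS]

theorem card_SS (k w : ℕ) : (SS k w).card = gb k w := by
  have h := card_below (DD k) w
  rw [finrank_DD] at h
  rw [← h, ← natCard_coe]
  exact Nat.card_congr (Equiv.subtypeEquivRight fun W => mem_SS)

/-- number of extensions -/
def nExt (k w s : ℕ) : ℕ := if s ≤ w then gb (k - s) (w - s) else 0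

open Classical in
theorem moment (k w j : ℕ) :
    ∑ W ∈ SS (k + 1) w, gb (gg W) j = ∑ H ∈ SS k j, nExt (k + 1) w (2 * j - gg H) := by
  have h := Finset.sum_card_bipartiteAbove_eq_sum_card_bipartiteBelow
    (fun W H : Submodule Ftwo Ftwo[X] => H ≤ GG W) (s := SS (k + 1) w) (t := SS k j)
  convert h using 1
  · apply Finset.sum_congr rfl
    intro W hW
    rw [mem_SS] at hW
    have hG := GG_le k W hW.1
    have : Finite (GG W) := finite_of_le hG
    rw [gg, ← card_below, ← natCard_coe]
    apply Nat.card_congr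
    apply Equiv.subtypeEquivRight
    intro H
    rw [Finset.mem_bipartiteAbove, mem_SS]
    constructor
    · rintro ⟨h1, h2⟩; exact ⟨⟨h1.trans hG, h2⟩, h1⟩
    · rintro ⟨h1, h2⟩; exact ⟨h2, h1.2⟩
  · apply Finset.sum_congr rfl
    intro H hH
    rw [mem_SS] at hH
    have : Finite H := finite_of_le hH.1
    have hs := finrank_shift H
    rw [hH.2] at hs
    have hs2 : 2 * j - gg H = finrank Ftwo (H ⊔ H.map mX : Submodule Ftwo Ftwo[X]) := by omega
    rw [hs2, nExt]
    have key : ∀ W : Submodule Ftwo Ftwo[X], H ≤ GG W ↔ H ⊔ H.map mX ≤ W := by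
      intro W
      rw [GG, le_inf_iff, sup_le_iff, Submodule.map_le_iff_le_comap]
    split_ifs with hw
    · have h3 := card_between (H ⊔ H.map mX) (DD (k + 1)) (map_mX_le k H hH.1) w hw
      rw [finrank_DD] at h3
      rw [← h3, ← natCard_coe]
      apply Nat.card_congr
      apply Equiv.subtypeEquivRight
      intro W
      rw [Finset.mem_bipartiteBelow, mem_SS, key]
      tauto
    · symm
      rw [Finset.card_eq_zero, Finset.eq_empty_iff_forall_notMem]
      intro W hW
      rw [Finset.mem_bipartiteBelow, mem_SS, key] at hW
      have : Finite W := finite_of_le hW.1.1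
      have := Submodule.finrank_mono hW.2
      omega

/-- number of subspaces with given shift dimension -/
noncomputable def NN (k w g : ℕ) : ℕ := ((SS k w).filter (fun W => gg W = g)).card

theorem sum_gg (k w : ℕ) (f : ℕ → ℕ) :
    ∑ W ∈ SS k (w + 1), f (gg W) = ∑ g ∈ range (w + 1), NN k (w + 1) g * f g := by
  rw [← Finset.sum_fiberwise_of_maps_to (s := SS k (w + 1)) (t := range (w + 1)) (g := gg)]
  · apply Finset.sum_congr rfl
    intro g _
    rw [NN, ← smul_eq_mul, ← Finset.sum_const]
    apply Finset.sum_congr rfl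
    intro W hW
    rw [(Finset.mem_filter.1 hW).2]
  · intro W hW
    rw [mem_SS] at hW
    rw [Finset.mem_range, ← hW.2]
    exact gg_lt k W hW.1 (by omega)

theorem mom (k w j : ℕ) :
    ∑ g ∈ range (w + 1), NN (k + 1) (w + 1) g * gb g (j + 1) =
      ∑ g ∈ range (j + 1), NN k (j + 1) g * nExt (k + 1) (w + 1) (2 * (j + 1) - g) := by
  rw [← sum_gg (k + 1) w (fun g => gb g (j + 1)), moment,
    ← sum_gg k j (fun g => nExt (k + 1) (w + 1) (2 * (j + 1) - g))]

theorem tot (k w : ℕ) : ∑ g ∈ range (w + 1), NN k (w + 1) g = gb k (w + 1) := by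
  have := sum_gg k w (fun _ => 1)
  simp only [mul_one] at this
  rw [← this, ← card_SS]; simp

theorem gb_values : gb 0 1 = 0 ∧
    gb 0 2 = 0 ∧
    gb 0 3 = 0 ∧
    gb 1 1 = 1 ∧
    gb 1 2 = 0 ∧
    gb 1 3 = 0 ∧
    gb 2 1 = 3 ∧
    gb 2 2 = 1 ∧
    gb 2 3 = 0 ∧
    gb 3 1 = 7 ∧
    gb 3 2 = 7 ∧
    gb 3 3 = 1 ∧
    gb 7 1 = 127 ∧
    gb 8 1 = 255 ∧
    gb 9 1 = 511 ∧
    gb 9 2 = 43435 ∧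
    gb 10 1 = 1023 ∧
    gb 10 2 = 174251 ∧
    gb 10 3 = 6347715 ∧
    gb 10 4 = 53743987 := by
  decide +kernel

theorem nExt_values : nExt 8 2 2 = 1 ∧
    nExt 9 2 2 = 1 ∧
    nExt 9 3 3 = 1 ∧
    nExt 9 3 4 = 0 ∧
    nExt 10 2 2 = 1 ∧
    nExt 10 3 2 = 255 ∧
    nExt 10 3 3 = 1 ∧
    nExt 10 3 4 = 0 ∧
    nExt 10 4 2 = 10795 ∧
    nExt 10 4 3 = 127 ∧
    nExt 10 4 4 = 1 ∧
    nExt 10 4 5 = 0 ∧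
    nExt 10 4 6 = 0 := by
  decide +kernel

theorem values : NN 10 1 0 = 1023 ∧ NN 10 2 1 = 511 ∧ NN 10 2 0 = 173740 ∧
    NN 10 3 2 = 255 ∧ NN 10 3 1 = 129540 ∧ NN 10 3 0 = 6217920 ∧
    NN 10 4 3 = 127 ∧ NN 10 4 2 = 74676 ∧ NN 10 4 1 = 5291328 ∧ NN 10 4 0 = 48377856 := by
  have a7 := tot 7 0
  have a8 := tot 8 0
  have a9 := tot 9 0
  have a10 := tot 10 0
  have b9 := tot 9 1
  have b10 := tot 10 1
  have c10 := tot 10 2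
  have d10 := tot 10 3
  have m1 := mom 7 1 0
  have m2 := mom 8 1 0
  have m3 := mom 9 1 0
  have m4 := mom 8 2 1
  have m5 := mom 9 2 1
  have m6 := mom 9 2 0
  have m7 := mom 9 3 2
  have m8 := mom 9 3 1
  have m9 := mom 9 3 0
  simp only [Finset.sum_range_succ, Finset.sum_range_zero, Nat.reduceAdd, Nat.reduceMul,
    Nat.reduceSub, gb_values, nExt_values] at a7 a8 a9 a10 b9 b10 c10 d10 m1 m2 m3 m4 m5 m6 m7 m8 m9
  omega

end poly

section final

/-- the relations of degree at most one -/
abbrev KK (Y : Fin 4 → Ftwo[X]) : Type :=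
  {U : Fin 4 → Ftwo[X] // (∀ i, (U i).degree ≤ 1) ∧ ∑ i, Y i * U i = 0}

noncomputable def Phi (Y : Fin 4 → Ftwo[X]) :
    ((Fin 4 → Ftwo) × (Fin 4 → Ftwo)) →ₗ[Ftwo] Ftwo[X] :=
  LinearMap.coprod (Fintype.linearCombination Ftwo Y)
    (mX ∘ₗ Fintype.linearCombination Ftwo Y)

theorem Phi_apply (Y : Fin 4 → Ftwo[X]) (a b : Fin 4 → Ftwo) :
    Phi Y (a, b) = ∑ i, Y i * (C (b i) * X + C (a i)) := by
  simp only [Phi, LinearMap.coprod_apply, Fintype.linearCombination_apply, LinearMap.comp_apply,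
    mX_apply, Finset.mul_sum, ← Finset.sum_add_distrib, Polynomial.smul_eq_C_mul]
  apply Finset.sum_congr rfl
  intro i _
  ring

noncomputable def kerEquiv (Y : Fin 4 → Ftwo[X]) : (Phi Y).ker ≃ KK Y where
  toFun z := ⟨fun i => C (z.1.2 i) * X + C (z.1.1 i), fun i => degree_linear_le, by
    have h := z.2
    rw [LinearMap.mem_ker] at h
    rw [← h]
    exact (Phi_apply Y z.1.1 z.1.2).symm⟩
  invFun U := ⟨(fun i => (U.1 i).coeff 0, fun i => (U.1 i).coeff 1), by
    rw [LinearMap.mem_ker, Phi_apply]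
    refine Eq.trans ?_ U.2.2
    apply Finset.sum_congr rfl
    intro i _
    rw [← eq_X_add_C_of_degree_le_one (U.2.1 i)]⟩
  left_inv := by
    rintro ⟨⟨a, b⟩, h⟩
    apply Subtype.ext
    simp
  right_inv := by
    rintro ⟨U, h⟩
    apply Subtype.ext
    funext i
    exact (eq_X_add_C_of_degree_le_one (h.1 i)).symm

theorem card_KK (Y : Fin 4 → Ftwo[X]) (w : ℕ)
    (hw : finrank Ftwo (Submodule.span Ftwo (Set.range Y)) = w) :
    Nat.card (KK Y) = 2 ^ (8 - 2 * w + gg (Submodule.span Ftwo (Set.range Y))) := by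
  have : Finite (Submodule.span Ftwo (Set.range Y)) := by
    have : FiniteDimensional Ftwo (Submodule.span Ftwo (Set.range Y)) :=
      FiniteDimensional.span_of_finite Ftwo (Set.finite_range Y)
    exact Module.finite_of_finite Ftwo
  have h0 := finrank_shift (Submodule.span Ftwo (Set.range Y))
  have h1 := LinearMap.finrank_range_add_finrank_ker (Phi Y)
  have h2 : (Phi Y).range = Submodule.span Ftwo (Set.range Y) ⊔
      (Submodule.span Ftwo (Set.range Y)).map mX := by
    rw [Phi, LinearMap.range_coprod, LinearMap.range_comp, Fintype.range_linearCombination]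
  have h4 : finrank Ftwo (Submodule.span Ftwo (Set.range Y)) ≤ 4 := by
    have := finrank_range_le_card (R := Ftwo) Y
    simpa [Set.finrank] using this
  rw [h2] at h1
  simp at h1
  rw [← Nat.card_congr (kerEquiv Y), Module.natCard_eq_pow_finrank (K := Ftwo), Nat.card_zmod]
  congr 1
  omega

/-- four-tuples with bounded degree -/
abbrev YY : Type := {Y : Fin 4 → Ftwo[X] // ∀ i, (Y i).degree ≤ 9}

theorem deg_iff (p : Ftwo[X]) : p.degree ≤ 9 ↔ p ∈ DD 10 := by
  rw [mem_degreeLT]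
  by_cases hp : p = 0
  · simp only [hp, degree_zero, bot_le, true_iff]
    exact WithBot.bot_lt_coe _
  · rw [degree_eq_natDegree hp]
    norm_cast
    omega

instance : Finite YY := by
  apply Finite.of_injective (fun (Y : YY) (i : Fin 4) => (⟨Y.1 i, (deg_iff _).1 (Y.2 i)⟩ : DD 10))
  intro Y Z h
  apply Subtype.ext
  funext i
  exact congrArg Subtype.val (congrFun h i)

noncomputable def bigEquiv (n : ℕ) :
    {YU : (Fin 4 → Polynomial (ZMod 2)) × (Fin n → Fin 4 → Polynomial (ZMod 2)) //
        (∀ i, (YU.1 i).degree ≤ 9) ∧ (∀ j i, (YU.2 j i).degree ≤ 1) ∧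
        (∀ j, ∑ i, YU.1 i * YU.2 j i = 0)} ≃ (Σ Y : YY, (Fin n → KK Y.1)) where
  toFun z := ⟨⟨z.1.1, z.2.1⟩, fun j => ⟨z.1.2 j, z.2.2.1 j, z.2.2.2 j⟩⟩
  invFun z := ⟨(z.1.1, fun j => (z.2 j).1), z.1.2, fun j => (z.2 j).2.1, fun j => (z.2 j).2.2⟩
  left_inv _ := rfl
  right_inv _ := rfl

noncomputable abbrev spn (Y : YY) : Submodule Ftwo Ftwo[X] := Submodule.span Ftwo (Set.range Y.1)

theorem spn_le (Y : YY) : spn Y ≤ DD 10 := by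
  rw [Submodule.span_le]
  rintro _ ⟨i, rfl⟩
  exact (deg_iff _).1 (Y.2 i)

theorem finrank_spn (Y : YY) : finrank Ftwo (spn Y) ≤ 4 := by
  have := finrank_range_le_card (R := Ftwo) Y.1
  simpa [Set.finrank] using this

theorem card_fibre (W : Submodule Ftwo Ftwo[X]) (w : ℕ) (hw : w ≤ 4) (hW : W ∈ SS 10 w) :
    Nat.card {Y : YY // spn Y = W} = ∏ i : Fin w, (2 ^ 4 - 2 ^ i.val) := by
  rw [mem_SS] at hW
  obtain ⟨h1, rfl⟩ := hW
  have : Finite W := finite_of_le h1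
  rw [← card_span W hw]
  refine Nat.card_congr
    { toFun := fun Y => ⟨Y.1.1, Y.2⟩
      invFun := fun Y => ⟨⟨Y.1, fun i => (deg_iff _).2 (h1 (Y.2.le
        (Submodule.subset_span ⟨i, rfl⟩)))⟩, Y.2⟩
      left_inv := fun Y => rfl
      right_inv := fun Y => rfl }

open Classical in
theorem total (n : ℕ) [Fintype YY] :
    ∑ Y : YY, Nat.card (KK Y.1) ^ n = ∑ w ∈ range 5, ∑ W ∈ SS 10 w,
      (∏ i : Fin w, (2 ^ 4 - 2 ^ i.val)) * (2 ^ (8 - 2 * w + gg W)) ^ n := by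
  rw [← Finset.sum_fiberwise_of_maps_to (s := Finset.univ) (t := range 5)
    (g := fun Y : YY => finrank Ftwo (spn Y))]
  · apply Finset.sum_congr rfl
    intro w hw
    rw [← Finset.sum_fiberwise_of_maps_to (t := SS 10 w) (g := fun Y : YY => spn Y)]
    · apply Finset.sum_congr rfl
      intro W hW
      rw [← card_fibre W w (by have := Finset.mem_range.1 hw; omega) hW, ← smul_eq_mul]
      have hc : Nat.card {Y : YY // spn Y = W} =
          ((Finset.univ.filter (fun Y : YY => finrank Ftwo (spn Y) = w)).filter
            (fun Y => spn Y = W)).card := by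
        rw [← natCard_coe]
        apply Nat.card_congr
        apply Equiv.subtypeEquivRight
        intro Y
        simp only [Finset.mem_filter, Finset.mem_univ, true_and]
        constructor
        · rintro rfl
          exact ⟨(mem_SS.1 hW).2, rfl⟩
        · exact fun h => h.2
      rw [hc, ← Finset.sum_const]
      apply Finset.sum_congr rfl
      intro Y hY
      simp only [Finset.mem_filter, Finset.mem_univ, true_and] at hY
      rw [card_KK Y.1 w hY.1]
      change (2 ^ (8 - 2 * w + gg (spn Y))) ^ n = _
      rw [hY.2]
    · intro Y hY
      simp only [Finset.mem_filter, Finset.mem_univ, true_and] at hY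
      exact mem_SS.2 ⟨spn_le Y, hY⟩
  · intro Y _
    have := finrank_spn Y
    rw [Finset.mem_range]; omega

theorem sum_zero (f : ℕ → ℕ) : ∑ W ∈ SS 10 0, f (gg W) = f 0 := by
  have h : SS 10 0 = {⊥} := by
    ext W
    rw [mem_SS, Finset.mem_singleton]
    constructor
    · rintro ⟨h1, h2⟩
      have : Finite W := finite_of_le h1
      exact Submodule.finrank_eq_zero.1 h2
    · rintro rfl
      exact ⟨bot_le, finrank_bot _ _⟩
  rw [h, Finset.sum_singleton, gg, GG, bot_inf_eq, finrank_bot]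

end final

theorem rcount_q_four_k_ten (n : ℕ) (hn : 1 ≤ n) :
    Nat.card {YU : (Fin 4 → Polynomial (ZMod 2)) × (Fin n → Fin 4 → Polynomial (ZMod 2)) //
        (∀ i, (YU.1 i).degree ≤ 9) ∧ (∀ j i, (YU.2 j i).degree ≤ 1) ∧
        (∀ j, ∑ i, YU.1 i * YU.2 j i = 0)}
      = 2 ^ (8 * n) + 15345 * 2 ^ (6 * n) + 107310 * 2 ^ (5 * n)
          + 37128000 * 2 ^ (4 * n) + 329001120 * 2 ^ (3 * n)
          + 67088385 * 2 ^ 8 * 2 ^ (2 * n) + 26043255 * 2 ^ 12 * 2 ^ n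
          + 14881860 * 2 ^ 16 := by
  have : Fintype YY := Fintype.ofFinite _
  have hfin : ∀ Y : YY, Finite (KK Y.1) := fun Y => Finite.of_equiv _ (kerEquiv Y.1)
  rw [Nat.card_congr (bigEquiv n), Nat.card_sigma]
  simp only [Nat.card_fun, Nat.card_eq_fintype_card (α := Fin n), Fintype.card_fin]
  rw [total]
  have s0 := sum_zero (fun g => (∏ i : Fin 0, (2 ^ 4 - 2 ^ i.val)) * (2 ^ (8 - 2 * 0 + g)) ^ n)
  have s1 := sum_gg 10 0 (fun g => (∏ i : Fin 1, (2 ^ 4 - 2 ^ i.val)) * (2 ^ (8 - 2 * 1 + g)) ^ n)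
  have s2 := sum_gg 10 1 (fun g => (∏ i : Fin 2, (2 ^ 4 - 2 ^ i.val)) * (2 ^ (8 - 2 * 2 + g)) ^ n)
  have s3 := sum_gg 10 2 (fun g => (∏ i : Fin 3, (2 ^ 4 - 2 ^ i.val)) * (2 ^ (8 - 2 * 3 + g)) ^ n)
  have s4 := sum_gg 10 3 (fun g => (∏ i : Fin 4, (2 ^ 4 - 2 ^ i.val)) * (2 ^ (8 - 2 * 4 + g)) ^ n)
  rw [Finset.sum_range_succ, Finset.sum_range_succ, Finset.sum_range_succ, Finset.sum_range_succ,
    Finset.sum_range_succ, Finset.sum_range_zero, s0, s1, s2, s3, s4]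
  obtain ⟨v1, v2, v3, v4, v5, v6, v7, v8, v9, v10⟩ := values
  simp only [Finset.sum_range_succ, Finset.sum_range_zero, Nat.reduceAdd, v1, v2, v3, v4, v5, v6,
    v7, v8, v9, v10, ← pow_mul]
  simp only [Fin.prod_univ_succ]
  norm_num
  ring
end
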